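/- Let a > b be natural numbers. Let f : [0,1]^a → [0,1]^b be the projection to the first b coordinates, and define π : ([0,1]^a)^ℤ → ([0,1]^b)^ℤ by π((x_n)_{n∈ℤ}) = (f(x_n))_{n∈ℤ}. Then the conditional metric mean dimension of π exists and equals a − b: the upper and lower conditional metric mean dimensions of π with respect to the metric D coincide and mdim_M(π, σ, D) = a − b. -/

import Mathlib

open Filter Topology
open scoped ENNReal NNReal

noncomputable section

/-- Diameter (in `ℝ≥0∞`) of a set with respect to a distance function `ρ`. -/
def setEDiam {X : Type*} (ρ : X → X → ℝ) (E : Set X) : ℝ≥0∞ :=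
  ⨆ x ∈ E, ⨆ y ∈ E, ENNReal.ofReal (ρ x y)

/-- Openness with respect to a distance function `ρ`. -/
def ROpen {X : Type*} (ρ : X → X → ℝ) (U : Set X) : Prop :=
  ∀ x ∈ U, ∃ δ > 0, ∀ y, ρ x y < δ → y ∈ U

/-- `#(E, ρ, ε)`: the minimal number `n` of `ρ`-open sets of `ρ`-diameter `< ε` covering `E`
(`0` when `E = ∅`, since the empty family covers it). -/
def covNum {X : Type*} (ρ : X → X → ℝ) (ε : ℝ) (E : Set X) : ℕ :=
  sInf {n : ℕ | ∃ U : Fin n → Set X, (∀ i, ROpen ρ (U i)) ∧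
    (∀ i, setEDiam ρ (U i) < ENNReal.ofReal ε) ∧ E ⊆ ⋃ i, U i}

/-- The dynamical metric `d_N(x,y) = max_{0 ≤ n < N} d(Tⁿx, Tⁿy)`. -/
def dynDist {X : Type*} (T : X → X) (d : X → X → ℝ) (N : ℕ) (x y : X) : ℝ :=
  sSup {r : ℝ | ∃ n, n < N ∧ r = d (T^[n] x) (T^[n] y)}

/-- `sup_{y ∈ Y} log #(π⁻¹(y), ρ, ε)`. -/
def supLogCov {X Y : Type*} (π : X → Y) (ρ : X → X → ℝ) (ε : ℝ) : ℝ :=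
  ⨆ y : Y, Real.log (covNum ρ ε (π ⁻¹' {y}) : ℝ)

/-- `sup_{y ∈ Y} log #(π⁻¹(B_δ(y, ρY)), ρX, ε)` where `B_δ` is the closed `δ`-ball. -/
def supLogCovBall {X Y : Type*} (π : X → Y) (ρX : X → X → ℝ) (ρY : Y → Y → ℝ)
    (ε δ : ℝ) : ℝ :=
  ⨆ y : Y, Real.log (covNum ρX ε (π ⁻¹' {x | ρY x y ≤ δ}) : ℝ)

/-- Topological conditional entropy
`h_top(π, T) = lim_{ε→0} lim_{N→∞} (sup_y log #(π⁻¹(y), d_N, ε))/N`, as an extended real. -/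
def condEntropy {X Y : Type*} (π : X → Y) (T : X → X) (d : X → X → ℝ) : EReal :=
  Filter.limsup (fun ε : ℝ => Filter.liminf
      (fun N : ℕ => ((supLogCov π (dynDist T d N) ε / N : ℝ) : EReal)) Filter.atTop)
    (𝓝[>] (0 : ℝ))

/-- `lim_{N→∞} (sup_y log #(π⁻¹(y), d_N, ε))/(N log(1/ε))` (the limit exists by
subadditivity; it is realized here as a liminf). -/
def condMdimRate {X Y : Type*} (π : X → Y) (T : X → X) (d : X → X → ℝ) (ε : ℝ) : EReal :=
  Filter.liminf (fun N : ℕ =>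
    ((supLogCov π (dynDist T d N) ε / (N * Real.log (1 / ε)) : ℝ) : EReal)) Filter.atTop

/-- Lower conditional metric mean dimension of `π : (X,T,d) → Y`. -/
def lowerCondMdimM {X Y : Type*} (π : X → Y) (T : X → X) (d : X → X → ℝ) : EReal :=
  Filter.liminf (fun ε : ℝ => condMdimRate π T d ε) (𝓝[>] (0 : ℝ))

/-- Upper conditional metric mean dimension of `π : (X,T,d) → Y`. -/
def upperCondMdimM {X Y : Type*} (π : X → Y) (T : X → X) (d : X → X → ℝ) : EReal :=
  Filter.limsup (fun ε : ℝ => condMdimRate π T d ε) (𝓝[>] (0 : ℝ))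

/-- `lim_{N→∞} log #(X, d_N, ε)/(N log(1/ε))`. -/
def mdimMRate {X : Type*} (T : X → X) (d : X → X → ℝ) (ε : ℝ) : EReal :=
  Filter.liminf (fun N : ℕ =>
    ((Real.log (covNum (dynDist T d N) ε (Set.univ : Set X) : ℝ) /
      (N * Real.log (1 / ε)) : ℝ) : EReal)) Filter.atTop

/-- Lower metric mean dimension of `(X, T, d)`. -/
def lowerMdimM {X : Type*} (T : X → X) (d : X → X → ℝ) : EReal :=
  Filter.liminf (fun ε : ℝ => mdimMRate T d ε) (𝓝[>] (0 : ℝ))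

/-- Upper metric mean dimension of `(X, T, d)`. -/
def upperMdimM {X : Type*} (T : X → X) (d : X → X → ℝ) : EReal :=
  Filter.limsup (fun ε : ℝ => mdimMRate T d ε) (𝓝[>] (0 : ℝ))

/-- `widim_ε(X, ρ)`: the minimal `k` such that there are a finite simplicial complex of
dimension `≤ k` (realized in some `ℝ^m`) and a continuous `ε`-embedding `f : X → P`
(all fibers of `f` have `ρ`-diameter `< ε`). -/
def widim (X : Type*) [TopologicalSpace X] (ρ : X → X → ℝ) (ε : ℝ) : ℕ :=
  sInf {k : ℕ | ∃ (m : ℕ) (K : Geometry.SimplicialComplex ℝ (Fin m → ℝ)),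
    K.faces.Finite ∧ (∀ s ∈ K.faces, s.card ≤ k + 1) ∧
    ∃ f : X → K.space, Continuous f ∧
      ∀ p : K.space, setEDiam ρ (f ⁻¹' {p}) < ENNReal.ofReal ε}

/-- Mean dimension `mdim(X, T) = lim_{ε→0} lim_{N→∞} widim_ε(X, d_N)/N`. -/
def mdim (X : Type*) [TopologicalSpace X] (T : X → X) (d : X → X → ℝ) : EReal :=
  Filter.limsup (fun ε : ℝ => Filter.liminf
      (fun N : ℕ => (((widim X (dynDist T d N) ε : ℝ) / N : ℝ) : EReal)) Filter.atTop)
    (𝓝[>] (0 : ℝ))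

/-- The cube `[0,1]^a`. -/
abbrev Cube (a : ℕ) := Fin a → unitInterval

/-- The full shift space `([0,1]^a)^ℤ`. -/
abbrev FullShift (a : ℕ) := ℤ → Cube a

/-- The shift map `σ((x_n)_n) = (x_{n+1})_n`. -/
def shift {α : Type*} (x : ℤ → α) : ℤ → α := fun n => x (n + 1)

/-- The `ℓ^∞`-distance on the cube `[0,1]^a`. -/
def cubeDist {a : ℕ} (x y : Cube a) : ℝ :=
  ‖(fun i => (x i : ℝ)) - fun i => (y i : ℝ)‖

/-- The metric `D((x_n), (y_n)) = Σ_{n∈ℤ} 2^{-|n|} ‖x_n − y_n‖_∞` on the full shift. -/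
def shiftDist {a : ℕ} (x y : FullShift a) : ℝ :=
  ∑' n : ℤ, (2 : ℝ) ^ (-|n|) * cubeDist (x n) (y n)

end

theorem log_natCast_mono {m n : ℕ} (h : m ≤ n) : Real.log m ≤ Real.log n := by
  rcases m.eq_zero_or_pos with rfl | hm
  · simpa using Real.log_natCast_nonneg n
  · exact Real.log_le_log (Nat.cast_pos.2 hm) (Nat.cast_le.2 h)

theorem covNum_le_card {X ι : Type*} [Fintype ι] {ρ : X → X → ℝ} {ε : ℝ} {E : Set X}
    (U : ι → Set X) (hU : ∀ i, ROpen ρ (U i))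
    (hd : ∀ i, setEDiam ρ (U i) < ENNReal.ofReal ε) (hE : E ⊆ ⋃ i, U i) :
    covNum ρ ε E ≤ Fintype.card ι := by
  refine Nat.sInf_le ⟨fun j => U ((Fintype.equivFin ι).symm j), fun _ => hU _, fun _ => hd _, ?_⟩
  intro x hx
  obtain ⟨i, hi⟩ := Set.mem_iUnion.1 (hE hx)
  exact Set.mem_iUnion.2 ⟨Fintype.equivFin ι i, by simpa using hi⟩

/-- An `ε`-separated family in `E` bounds the covering number from below, as soon as `E` admits
some finite cover. -/
theorem card_le_covNum {X ι κ : Type*} [Fintype ι] [Fintype κ] {ρ : X → X → ℝ} {ε : ℝ}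
    {E : Set X} (p : ι → X) (hp : ∀ i, p i ∈ E) (hsep : ∀ i j, i ≠ j → ε ≤ ρ (p i) (p j))
    (U : κ → Set X) (hU : ∀ i, ROpen ρ (U i))
    (hd : ∀ i, setEDiam ρ (U i) < ENNReal.ofReal ε) (hE : E ⊆ ⋃ i, U i) :
    Fintype.card ι ≤ covNum ρ ε E := by
  have hne : {n : ℕ | ∃ U : Fin n → Set X, (∀ i, ROpen ρ (U i)) ∧
      (∀ i, setEDiam ρ (U i) < ENNReal.ofReal ε) ∧ E ⊆ ⋃ i, U i}.Nonempty := by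
    refine ⟨Fintype.card κ, fun j => U ((Fintype.equivFin κ).symm j), fun _ => hU _,
      fun _ => hd _, ?_⟩
    intro x hx
    obtain ⟨i, hi⟩ := Set.mem_iUnion.1 (hE hx)
    exact Set.mem_iUnion.2 ⟨Fintype.equivFin κ i, by simpa using hi⟩
  obtain ⟨V, -, hVd, hVE⟩ := Nat.sInf_mem hne
  choose c hc using fun i => Set.mem_iUnion.1 (hVE (hp i))
  have hinj : Function.Injective c := by
    intro i j hij
    by_contra hne
    refine (hVd (c i)).not_ge ((ENNReal.ofReal_le_ofReal (hsep i j hne)).trans ?_)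
    have hj : p j ∈ V (c i) := by rw [hij]; exact hc j
    exact le_iSup₂_of_le (p i) (hc i)
      (le_iSup₂_of_le (f := fun y (_ : y ∈ V (c i)) => ENNReal.ofReal (ρ (p i) y))
        (p j) hj le_rfl)
  exact (Fintype.card_le_of_injective c hinj).trans_eq (Fintype.card_fin _)

section DynDist

variable {X : Type*} {T : X → X} {d : X → X → ℝ} {N : ℕ}

theorem le_dynDist {n : ℕ} (hn : n < N) (x y : X) :
    d (T^[n] x) (T^[n] y) ≤ dynDist T d N x y := by
  refine le_csSup (Set.Finite.bddAbove ?_) ⟨n, hn, rfl⟩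
  refine ((Set.finite_Iio N).image fun n => d (T^[n] x) (T^[n] y)).subset ?_
  rintro r ⟨n, hn, rfl⟩
  exact ⟨n, hn, rfl⟩

theorem dynDist_le {r : ℝ} (hr : 0 ≤ r) {x y : X}
    (h : ∀ n < N, d (T^[n] x) (T^[n] y) ≤ r) : dynDist T d N x y ≤ r := by
  refine Real.sSup_le ?_ hr
  rintro _ ⟨n, hn, rfl⟩
  exact h n hn

theorem dynDist_nonneg (h0 : ∀ x y, 0 ≤ d x y) (x y : X) : 0 ≤ dynDist T d N x y := by
  refine Real.sSup_nonneg ?_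
  rintro _ ⟨n, -, rfl⟩
  exact h0 _ _

theorem dynDist_comm (hc : ∀ x y, d x y = d y x) (x y : X) :
    dynDist T d N x y = dynDist T d N y x := by
  simp only [dynDist, hc (T^[_] x)]

theorem dynDist_triangle (h0 : ∀ x y, 0 ≤ d x y) (ht : ∀ x y z, d x z ≤ d x y + d y z)
    (x y z : X) : dynDist T d N x z ≤ dynDist T d N x y + dynDist T d N y z :=
  dynDist_le (add_nonneg (dynDist_nonneg h0 _ _) (dynDist_nonneg h0 _ _)) fun _ hn =>
    (ht _ _ _).trans (add_le_add (le_dynDist hn _ _) (le_dynDist hn _ _))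

end DynDist

theorem rOpen_ball {X : Type*} {ρ : X → X → ℝ} (hc : ∀ x y, ρ x y = ρ y x)
    (ht : ∀ x y z, ρ x z ≤ ρ x y + ρ y z) (p : X) (r : ℝ) : ROpen ρ {x | ρ x p < r} := by
  intro x hx
  refine ⟨r - ρ x p, sub_pos.2 hx, fun y hy => ?_⟩
  have := ht y x p
  rw [hc y x] at this
  change ρ y p < r
  linarith

theorem setEDiam_ball_le {X : Type*} {ρ : X → X → ℝ} (hc : ∀ x y, ρ x y = ρ y x)
    (ht : ∀ x y z, ρ x z ≤ ρ x y + ρ y z) (p : X) (r : ℝ) :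
    setEDiam ρ {x | ρ x p < r} ≤ ENNReal.ofReal (2 * r) := by
  refine iSup₂_le fun x hx => iSup₂_le fun y hy => ENNReal.ofReal_le_ofReal ?_
  have := ht x p y
  rw [hc p y] at this
  have hx : ρ x p < r := hx
  have hy : ρ y p < r := hy
  linarith

section CubeDist

variable {a : ℕ}

theorem cubeDist_nonneg (x y : Cube a) : 0 ≤ cubeDist x y := norm_nonneg _

theorem cubeDist_comm (x y : Cube a) : cubeDist x y = cubeDist y x := norm_sub_rev _ _

theorem cubeDist_triangle (x y z : Cube a) : cubeDist x z ≤ cubeDist x y + cubeDist y z :=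
  norm_sub_le_norm_sub_add_norm_sub _ _ _

theorem cubeDist_le {x y : Cube a} {r : ℝ} (hr : 0 ≤ r)
    (h : ∀ i, |(x i : ℝ) - y i| ≤ r) : cubeDist x y ≤ r :=
  (pi_norm_le_iff_of_nonneg hr).2 h

theorem abs_sub_le_cubeDist (x y : Cube a) (i : Fin a) : |(x i : ℝ) - y i| ≤ cubeDist x y :=
  norm_le_pi_norm ((fun i => (x i : ℝ)) - fun i => (y i : ℝ)) i

theorem cubeDist_le_one (x y : Cube a) : cubeDist x y ≤ 1 :=
  cubeDist_le zero_le_one fun i => by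
    have h1 := (x i).2
    have h2 := (y i).2
    exact abs_le.2 ⟨by linarith [h1.1, h2.2], by linarith [h1.2, h2.1]⟩

end CubeDist

theorem summable_two_zpow_neg_abs : Summable fun n : ℤ => (2 : ℝ) ^ (-|n|) := by
  have h : Summable fun n : ℕ => (2 : ℝ) ^ (-|(n : ℤ)|) := by
    simpa [zpow_neg, ← inv_pow] using
      summable_geometric_of_lt_one (r := (2 : ℝ)⁻¹) (by norm_num) (by norm_num)
  exact Summable.of_nat_of_neg h (by simpa using h)

section ShiftDist

variable {a : ℕ}

theorem summable_shiftDist (x y : FullShift a) :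
    Summable fun n : ℤ => (2 : ℝ) ^ (-|n|) * cubeDist (x n) (y n) :=
  summable_two_zpow_neg_abs.of_nonneg_of_le
    (fun _ => mul_nonneg (by positivity) (cubeDist_nonneg _ _))
    (fun _ => mul_le_of_le_one_right (by positivity) (cubeDist_le_one _ _))

theorem shiftDist_nonneg (x y : FullShift a) : 0 ≤ shiftDist x y :=
  tsum_nonneg fun _ => mul_nonneg (by positivity) (cubeDist_nonneg _ _)

theorem shiftDist_comm (x y : FullShift a) : shiftDist x y = shiftDist y x := by
  simp only [shiftDist, cubeDist_comm (x _)]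

theorem shiftDist_triangle (x y z : FullShift a) :
    shiftDist x z ≤ shiftDist x y + shiftDist y z := by
  unfold shiftDist
  rw [← (summable_shiftDist x y).tsum_add (summable_shiftDist y z)]
  refine (summable_shiftDist x z).tsum_le_tsum (fun n => ?_)
    ((summable_shiftDist x y).add (summable_shiftDist y z))
  rw [← mul_add]
  exact mul_le_mul_of_nonneg_left (cubeDist_triangle _ _ _) (by positivity)

theorem cubeDist_zero_le_shiftDist (x y : FullShift a) : cubeDist (x 0) (y 0) ≤ shiftDist x y := by
  have := (summable_shiftDist x y).le_tsum 0
    fun _ _ => mul_nonneg (by positivity) (cubeDist_nonneg _ _)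
  simpa [shiftDist] using this

theorem shiftDist_le {x y : FullShift a} {s : Finset ℤ} {η : ℝ}
    (h : ∀ n ∈ s, cubeDist (x n) (y n) ≤ η) (hη : 0 ≤ η) :
    shiftDist x y ≤ η * ∑' n : ℤ, (2 : ℝ) ^ (-|n|) +
      ∑' n : {n // n ∉ s}, (2 : ℝ) ^ (-|(n : ℤ)|) := by
  have hs := summable_two_zpow_neg_abs
  unfold shiftDist
  rw [← (summable_shiftDist x y).sum_add_tsum_subtype_compl s, mul_comm η]
  refine add_le_add ?_ ?_
  · calc _ ≤ ∑ n ∈ s, (2 : ℝ) ^ (-|n|) * η :=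
          Finset.sum_le_sum fun n hn => mul_le_mul_of_nonneg_left (h n hn) (by positivity)
      _ = (∑ n ∈ s, (2 : ℝ) ^ (-|n|)) * η := (Finset.sum_mul ..).symm
      _ ≤ _ := mul_le_mul_of_nonneg_right (hs.sum_le_tsum s fun _ _ => by positivity) hη
  · exact ((summable_shiftDist x y).subtype _).tsum_le_tsum
      (fun _ => mul_le_of_le_one_right (by positivity) (cubeDist_le_one _ _)) (hs.subtype _)

theorem iterate_shift_apply {α : Type*} (k : ℕ) (x : ℤ → α) (n : ℤ) :
    shift^[k] x n = x (n + k) := by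
  induction k generalizing x with
  | zero => simp
  | succ k ih => rw [Function.iterate_succ_apply, ih]; simp [shift, add_assoc]

end ShiftDist

/-- The point over `y` whose remaining coordinates at times in `W` are prescribed multiples
of `1 / m`. -/
noncomputable def gridPoint {a b m : ℕ} (W : Finset ℤ) (y : FullShift b)
    (k : W → Fin (a - b) → Fin (m + 1)) : FullShift a := fun n i =>
  if h : (i : ℕ) < b then y n ⟨i, h⟩
  else if hn : n ∈ W then
    ⟨(k ⟨n, hn⟩ ⟨i - b, Nat.sub_lt_sub_right (not_lt.1 h) i.2⟩ : ℕ) / (m : ℝ),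
      unitInterval.div_mem (Nat.cast_nonneg _) (Nat.cast_nonneg _)
        (Nat.cast_le.2 (Nat.lt_succ_iff.1 (Fin.is_lt _)))⟩
  else 0

theorem exists_abs_sub_div_le {m : ℕ} (hm : 0 < m) (t : unitInterval) :
    ∃ k : Fin (m + 1), |(t : ℝ) - (k : ℕ) / (m : ℝ)| ≤ 1 / m := by
  have hm' : (0 : ℝ) < m := Nat.cast_pos.2 hm
  have h0 : 0 ≤ (t : ℝ) * m := mul_nonneg t.2.1 hm'.le
  have h1 : ⌊(t : ℝ) * m⌋₊ < m + 1 := by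
    rw [Nat.lt_succ_iff]
    refine Nat.floor_le_of_le ?_
    nlinarith [t.2.2]
  refine ⟨⟨⌊(t : ℝ) * m⌋₊, h1⟩, ?_⟩
  have e : (t : ℝ) - (⌊(t : ℝ) * m⌋₊ : ℝ) / m = (t * m - ⌊(t : ℝ) * m⌋₊) / m := by
    field_simp
  rw [e, abs_div, abs_of_pos hm']
  refine div_le_div_of_nonneg_right (abs_le.2 ⟨?_, ?_⟩) hm'.le
  · linarith [Nat.floor_le h0]
  · linarith [Nat.lt_floor_add_one ((t : ℝ) * m)]

theorem map_gridPoint {a b m : ℕ} (hab : b < a) {π : FullShift a → FullShift b}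
    (hπ : ∀ (x : FullShift a) (n : ℤ) (i : Fin b), π x n i = x n (Fin.castLE hab.le i))
    (W : Finset ℤ) (y : FullShift b) (k : W → Fin (a - b) → Fin (m + 1)) :
    π (gridPoint W y k) = y := by
  funext n i
  simp [hπ, gridPoint]

theorem exists_gridPoint {a b m : ℕ} (hab : b < a) {π : FullShift a → FullShift b}
    (hπ : ∀ (x : FullShift a) (n : ℤ) (i : Fin b), π x n i = x n (Fin.castLE hab.le i))
    (hm : 0 < m) (W : Finset ℤ) (x : FullShift a) :
    ∃ k : W → Fin (a - b) → Fin (m + 1),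
      ∀ n ∈ W, cubeDist (x n) (gridPoint W (π x) k n) ≤ 1 / m := by
  choose f hf using exists_abs_sub_div_le hm
  refine ⟨fun n j => f (x n ⟨j + b, by omega⟩), fun n hn => cubeDist_le (by positivity) ?_⟩
  intro i
  by_cases hi : (i : ℕ) < b
  · have : x n i = π x n ⟨i, hi⟩ := by rw [hπ]; rfl
    simp [gridPoint, hi, ← this]
  · have e : (⟨(i : ℕ) - b + b, by omega⟩ : Fin a) = i := Fin.ext (by simp; omega)
    simpa [gridPoint, hi, hn, e] using hf (x n i)

/-- Balls around grid points cover the fibers of the projection. -/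
theorem exists_fiber_cover {a b m : ℕ} (hab : b < a) {π : FullShift a → FullShift b}
    (hπ : ∀ (x : FullShift a) (n : ℤ) (i : Fin b), π x n i = x n (Fin.castLE hab.le i))
    (hm : 0 < m) {ε : ℝ} (hε : 0 < ε) {s : Finset ℤ}
    (hs : 1 / (m : ℝ) * ∑' n : ℤ, (2 : ℝ) ^ (-|n|) +
      ∑' n : {n // n ∉ s}, (2 : ℝ) ^ (-|(n : ℤ)|) < ε / 3)
    {L : ℕ} (hL : s ⊆ Finset.Icc (-L : ℤ) L) (N : ℕ) (y : FullShift b) :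
    ∃ U : (Finset.Icc (-L : ℤ) (L + N) → Fin (a - b) → Fin (m + 1)) → Set (FullShift a),
      (∀ k, ROpen (dynDist shift shiftDist N) (U k)) ∧
      (∀ k, setEDiam (dynDist shift shiftDist N) (U k) < ENNReal.ofReal ε) ∧
      π ⁻¹' {y} ⊆ ⋃ k, U k := by
  have hc := dynDist_comm (T := shift) (N := N) (shiftDist_comm (a := a))
  have ht := dynDist_triangle (T := shift) (N := N) (shiftDist_nonneg (a := a)) shiftDist_triangle
  refine ⟨fun k => {x | dynDist shift shiftDist N x (gridPoint _ y k) < ε / 3},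
    fun k => rOpen_ball hc ht _ _, fun k => (setEDiam_ball_le hc ht _ _).trans_lt ?_, ?_⟩
  · exact (ENNReal.ofReal_lt_ofReal_iff hε).2 (by linarith)
  · rintro x rfl
    obtain ⟨k, hk⟩ := exists_gridPoint hab hπ hm (Finset.Icc (-L : ℤ) (L + N)) x
    refine Set.mem_iUnion.2 ⟨k, (dynDist_le ?_ fun n hn => ?_).trans_lt hs⟩
    · positivity
    · refine shiftDist_le (fun j hj => ?_) (by positivity)
      simp only [iterate_shift_apply]
      refine hk _ ?_
      have := Finset.mem_Icc.1 (hL hj)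
      rw [Finset.mem_Icc]
      omega

theorem log_covNum_fiber_le {a b m : ℕ} (hab : b < a) {π : FullShift a → FullShift b}
    (hπ : ∀ (x : FullShift a) (n : ℤ) (i : Fin b), π x n i = x n (Fin.castLE hab.le i))
    (hm : 0 < m) {ε : ℝ} (hε : 0 < ε) {s : Finset ℤ}
    (hs : 1 / (m : ℝ) * ∑' n : ℤ, (2 : ℝ) ^ (-|n|) +
      ∑' n : {n // n ∉ s}, (2 : ℝ) ^ (-|(n : ℤ)|) < ε / 3)
    {L : ℕ} (hL : s ⊆ Finset.Icc (-L : ℤ) L) (N : ℕ) (y : FullShift b) :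
    Real.log (covNum (dynDist shift shiftDist N) ε (π ⁻¹' {y})) ≤
      (2 * L + N + 1) * ((a - b) * Real.log (m + 1)) := by
  obtain ⟨U, hU, hd, hE⟩ := exists_fiber_cover hab hπ hm hε hs hL N y
  have h := covNum_le_card U hU hd hE
  have hcard : (L + N + 1 - (-L) : ℤ).toNat = 2 * L + N + 1 := by omega
  rw [Fintype.card_fun, Fintype.card_fun, Fintype.card_fin, Fintype.card_fin, Fintype.card_coe,
    Int.card_Icc, hcard] at h
  have e : Real.log ((((m + 1) ^ (a - b)) ^ (2 * L + N + 1) : ℕ) : ℝ) =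
      (2 * L + N + 1) * ((a - b) * Real.log (m + 1)) := by
    push_cast [Real.log_pow, Nat.cast_sub hab.le]
    rfl
  rw [← e]
  exact log_natCast_mono h

theorem supLogCov_le {a b m : ℕ} (hab : b < a) {π : FullShift a → FullShift b}
    (hπ : ∀ (x : FullShift a) (n : ℤ) (i : Fin b), π x n i = x n (Fin.castLE hab.le i))
    (hm : 0 < m) {ε : ℝ} (hε : 0 < ε) {s : Finset ℤ}
    (hs : 1 / (m : ℝ) * ∑' n : ℤ, (2 : ℝ) ^ (-|n|) +
      ∑' n : {n // n ∉ s}, (2 : ℝ) ^ (-|(n : ℤ)|) < ε / 3)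
    {L : ℕ} (hL : s ⊆ Finset.Icc (-L : ℤ) L) (N : ℕ) :
    supLogCov π (dynDist shift shiftDist N) ε ≤
      (2 * L + N + 1) * ((a - b) * Real.log (m + 1)) :=
  ciSup_le fun y => log_covNum_fiber_le hab hπ hm hε hs hL N y

/-- The grid of mesh `1 / ⌊1 / ε⌋` in a fiber is `ε`-separated. -/
theorem le_supLogCov {a b m : ℕ} (hab : b < a) {π : FullShift a → FullShift b}
    (hπ : ∀ (x : FullShift a) (n : ℤ) (i : Fin b), π x n i = x n (Fin.castLE hab.le i))
    (hm : 0 < m) {ε : ℝ} (hε : 0 < ε) (hε1 : ε < 1) {s : Finset ℤ}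
    (hs : 1 / (m : ℝ) * ∑' n : ℤ, (2 : ℝ) ^ (-|n|) +
      ∑' n : {n // n ∉ s}, (2 : ℝ) ^ (-|(n : ℤ)|) < ε / 3)
    {L : ℕ} (hL : s ⊆ Finset.Icc (-L : ℤ) L) (N : ℕ) :
    N * ((a - b) * Real.log (1 / ε)) ≤ supLogCov π (dynDist shift shiftDist N) ε := by
  let y : FullShift b := fun _ _ => 0
  refine le_ciSup_of_le
    ⟨_, Set.forall_mem_range.2 fun y => log_covNum_fiber_le hab hπ hm hε hs hL N y⟩ y ?_
  obtain ⟨U, hU, hd, hE⟩ := exists_fiber_cover hab hπ hm hε hs hL N y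
  set M : ℕ := ⌊1 / ε⌋₊
  have hMpos : 0 < M := Nat.floor_pos.2 ((one_le_div hε).2 hε1.le)
  have hM' : (0 : ℝ) < M := Nat.cast_pos.2 hMpos
  have hεM : ε ≤ 1 / M := by
    rw [le_div_iff₀ hM', mul_comm, ← le_div_iff₀ hε]
    exact Nat.floor_le (by positivity)
  have h := card_le_covNum (ι := Finset.Ico (0 : ℤ) N → Fin (a - b) → Fin (M + 1))
    (fun k => gridPoint _ y k) (fun k => map_gridPoint hab hπ _ y k) ?_ U hU hd hE
  · rw [Fintype.card_fun, Fintype.card_fun, Fintype.card_fin, Fintype.card_fin, Fintype.card_coe,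
      Int.card_Ico, sub_zero, Int.toNat_natCast] at h
    refine le_trans ?_ (log_natCast_mono h)
    push_cast [Real.log_pow, Nat.cast_sub hab.le]
    have : (b : ℝ) ≤ a := Nat.cast_le.2 hab.le
    have hlog : Real.log (1 / ε) ≤ Real.log (M + 1) :=
      Real.log_le_log (by positivity) (Nat.lt_floor_add_one _).le
    exact mul_le_mul_of_nonneg_left
      (mul_le_mul_of_nonneg_left hlog (sub_nonneg.2 this)) (Nat.cast_nonneg _)
  · intro k l hkl
    obtain ⟨⟨n, hn⟩, hkl⟩ := Function.ne_iff.1 hkl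
    obtain ⟨i, hi⟩ := Function.ne_iff.1 hkl
    have hn' := Finset.mem_Ico.1 hn
    lift n to ℕ using hn'.1
    have hnN : n < N := by omega
    refine le_trans ?_ (le_dynDist hnN _ _)
    refine le_trans ?_ (cubeDist_zero_le_shiftDist _ _)
    refine le_trans ?_ (abs_sub_le_cubeDist _ _ ⟨i + b, by omega⟩)
    simp only [iterate_shift_apply, zero_add, gridPoint, hn, dite_true,
      dif_neg (show ¬ (i : ℕ) + b < b by omega), Nat.add_sub_cancel, Fin.eta]
    rw [← sub_div, abs_div, abs_of_pos hM']
    refine hεM.trans (div_le_div_of_nonneg_right ?_ hM'.le)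
    have : ((k ⟨n, hn⟩ i : ℕ) : ℤ) - (l ⟨n, hn⟩ i : ℕ) ≠ 0 := by
      rw [sub_ne_zero]
      exact fun h => hi (Fin.ext (by exact_mod_cast h))
    exact_mod_cast Int.one_le_abs this

/-- Truncation of the weights defining `shiftDist` to a symmetric window. -/
theorem exists_window {r : ℝ} (hr : 0 < r) :
    ∃ (s : Finset ℤ) (L : ℕ), ∑' n : {n // n ∉ s}, (2 : ℝ) ^ (-|(n : ℤ)|) < r ∧
      s ⊆ Finset.Icc (-L : ℤ) L := by
  obtain ⟨s, hs⟩ := ((tendsto_order.1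
    (tendsto_tsum_compl_atTop_zero fun n : ℤ => (2 : ℝ) ^ (-|n|))).2 r hr).exists
  refine ⟨s, s.sup Int.natAbs, hs, fun n hn => ?_⟩
  have : n.natAbs ≤ s.sup Int.natAbs := Finset.le_sup hn
  rw [Finset.mem_Icc]
  omega

theorem condMdimRate_bounds {a b : ℕ} (hab : b < a) {π : FullShift a → FullShift b}
    (hπ : ∀ (x : FullShift a) (n : ℤ) (i : Fin b), π x n i = x n (Fin.castLE hab.le i))
    {ε : ℝ} (hε : 0 < ε) (hε1 : ε < 1) :
    (((a : ℝ) - b : ℝ) : EReal) ≤ condMdimRate π shift shiftDist ε ∧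
      condMdimRate π shift shiftDist ε ≤ (((a - b) * (Real.log
        (6 * (∑' n : ℤ, (2 : ℝ) ^ (-|n|)) + 2) / Real.log (1 / ε) + 1) : ℝ) : EReal) := by
  set K : ℝ := ∑' n : ℤ, (2 : ℝ) ^ (-|n|)
  have hK : 0 < K := summable_two_zpow_neg_abs.tsum_pos (fun _ => by positivity) 0 (by simp)
  have hab' : (0 : ℝ) ≤ a - b := sub_nonneg.2 (Nat.cast_le.2 hab.le)
  have hlog : 0 < Real.log (1 / ε) := Real.log_pos ((one_lt_div hε).2 hε1)
  obtain ⟨s, L, hs, hL⟩ := exists_window (show 0 < ε / 6 by positivity)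
  set m : ℕ := ⌈6 * K / ε⌉₊
  have hm : 0 < m := Nat.ceil_pos.2 (by positivity)
  have hmε : 1 / (m : ℝ) * K ≤ ε / 6 := by
    have h := Nat.le_ceil (6 * K / ε)
    rw [div_le_iff₀ hε] at h
    rw [one_div_mul_eq_div, div_le_iff₀ (Nat.cast_pos.2 hm)]
    linarith
  have hs' : 1 / (m : ℝ) * K + ∑' n : {n // n ∉ s}, (2 : ℝ) ^ (-|(n : ℤ)|) < ε / 3 := by
    linarith
  have hm1 : Real.log (m + 1) ≤ Real.log (6 * K + 2) + Real.log (1 / ε) := by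
    rw [← Real.log_mul (by positivity) (by positivity)]
    refine Real.log_le_log (by positivity) ?_
    have h := Nat.ceil_lt_add_one (show 0 ≤ 6 * K / ε by positivity)
    have h1 : 1 ≤ 1 / ε := (one_le_div hε).2 hε1.le
    have e : (6 * K + 2) * (1 / ε) = 6 * K / ε + 2 * (1 / ε) := by ring
    linarith
  constructor
  · refine le_liminf_of_le (by isBoundedDefault) ?_
    filter_upwards [eventually_gt_atTop 0] with N hN
    have hN' : (0 : ℝ) < N := Nat.cast_pos.2 hN
    rw [EReal.coe_le_coe_iff, le_div_iff₀ (mul_pos hN' hlog)]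
    refine le_trans (le_of_eq (by ring)) (le_supLogCov hab hπ hm hε hε1 hs' hL N)
  · have hlim : Tendsto (fun N : ℕ => (((2 * L + 1 : ℝ) / N + 1) *
        ((a - b) * Real.log (m + 1) / Real.log (1 / ε)) : ℝ)) atTop
        (𝓝 ((0 + 1) * ((a - b) * Real.log (m + 1) / Real.log (1 / ε)))) :=
      ((tendsto_const_div_atTop_nhds_zero_nat _).add_const 1).mul_const _
    have hlim' := (continuous_coe_real_ereal.tendsto _).comp hlim
    refine le_trans ?_ (hlim'.liminf_eq.le.trans ?_)
    · refine liminf_le_liminf ?_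
      filter_upwards [eventually_gt_atTop 0] with N hN
      have hN' : (0 : ℝ) < N := Nat.cast_pos.2 hN
      rw [Function.comp_apply, EReal.coe_le_coe_iff, div_le_iff₀ (mul_pos hN' hlog)]
      refine (supLogCov_le hab hπ hm hε hs' hL N).trans (le_of_eq ?_)
      field_simp
      ring
    · rw [EReal.coe_le_coe_iff, zero_add, one_mul, mul_div_assoc]
      refine mul_le_mul_of_nonneg_left ?_ hab'
      rw [div_le_iff₀ hlog, add_mul, div_mul_cancel₀ _ hlog.ne', one_mul]
      exact hm1

theorem tendsto_condMdimRate {a b : ℕ} (hab : b < a) {π : FullShift a → FullShift b}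
    (hπ : ∀ (x : FullShift a) (n : ℤ) (i : Fin b), π x n i = x n (Fin.castLE hab.le i)) :
    Tendsto (condMdimRate π shift shiftDist) (𝓝[>] 0) (𝓝 (((a : ℝ) - b : ℝ) : EReal)) := by
  have hlog : Tendsto (fun ε : ℝ => Real.log (1 / ε)) (𝓝[>] 0) atTop := by
    simp only [one_div]
    exact Real.tendsto_log_atTop.comp tendsto_inv_nhdsGT_zero
  have hlim : Tendsto (fun ε : ℝ => ((a : ℝ) - b) * (Real.log
      (6 * (∑' n : ℤ, (2 : ℝ) ^ (-|n|)) + 2) / Real.log (1 / ε) + 1)) (𝓝[>] 0)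
      (𝓝 (((a : ℝ) - b) * (0 + 1))) :=
    ((hlog.const_div_atTop _).add_const 1).const_mul _
  rw [zero_add, mul_one] at hlim
  have hev : ∀ᶠ ε : ℝ in 𝓝[>] 0, 0 < ε ∧ ε < 1 := Ioo_mem_nhdsGT zero_lt_one
  exact tendsto_of_tendsto_of_tendsto_of_le_of_le' tendsto_const_nhds
    ((continuous_coe_real_ereal.tendsto _).comp hlim)
    (hev.mono fun ε h => (condMdimRate_bounds hab hπ h.1 h.2).1)
    (hev.mono fun ε h => (condMdimRate_bounds hab hπ h.1 h.2).2)

/-- For `a > b`, the coordinatewise projection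
`π : ([0,1]^a)^ℤ → ([0,1]^b)^ℤ` onto the first `b` coordinates has conditional metric mean
dimension exactly `a − b` (the upper and lower conditional metric mean dimensions coincide). -/
theorem stmt_3 (a b : ℕ) (hab : b < a) (π : FullShift a → FullShift b)
    (hπ : ∀ (x : FullShift a) (n : ℤ) (i : Fin b), π x n i = x n (Fin.castLE hab.le i)) :
    upperCondMdimM π shift shiftDist = (((a : ℝ) - (b : ℝ) : ℝ) : EReal) ∧
      lowerCondMdimM π shift shiftDist = (((a : ℝ) - (b : ℝ) : ℝ) : EReal) := by
  exact ⟨(tendsto_condMdimRate hab hπ).limsup_eq, (tendsto_condMdimRate hab hπ).liminf_eq⟩
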